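/- The element g = s2∘s1∘s3∘s0∘s2 of W_B (where s0 = w0, s1 = w2, s2 = w3, s3 = σ3) acts on the symmetry roots by g(α0) = δ − α0, g(α1) = δ − α1, g(α2) = δ − α2, and g(α3) = −α3 − δ; in particular g(α1 − α3) = 2δ − (α1 − α3), i.e. g sends the short simple root b3 = (α1−α3)/2 of the B3^(1) system to δ − b3. -/

import Mathlib

open Pointwise

/-- The Picard lattice `Pic`, with basis `H1, H2, E1, …, E8`
(coordinates `0 ↦ H1`, `1 ↦ H2`, `i+1 ↦ Eᵢ`). -/
abbrev Pic : Type := Fin 10 → ℤ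

/-- The intersection form `•` : `H1•H2 = 1`, `Eᵢ•Eᵢ = -1`, all other pairings
of basis vectors being `0`. -/
def inter (x y : Pic) : ℤ :=
  x 0 * y 1 + x 1 * y 0 -
    (x 2 * y 2 + x 3 * y 3 + x 4 * y 4 + x 5 * y 5 + x 6 * y 6 +
      x 7 * y 7 + x 8 * y 8 + x 9 * y 9)

/-- The `j`-th basis vector of `Pic`. -/
def bvec (j : Fin 10) : Pic := fun k => if k = j then 1 else 0

/-- The matrix of the reflection `C ↦ C + (C • a)·a` in `a`. -/
def reflMat (a : Pic) : Matrix (Fin 10) (Fin 10) ℤ :=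
  Matrix.of fun k j => (if k = j then 1 else 0) + inter (bvec j) a * a k

/-- The matrix of the linear map sending the basis vector `e j` to `e (p j)`. -/
def permMat (p : Fin 10 → Fin 10) : Matrix (Fin 10) (Fin 10) ℤ :=
  Matrix.of fun k j => if p j = k then 1 else 0

/-- `α₀ = H2 - E1 - E2`. -/
def al0 : Pic := ![0, 1, -1, -1, 0, 0, 0, 0, 0, 0]
/-- `α₁ = H1 - E5 - E6`. -/
def al1 : Pic := ![1, 0, 0, 0, 0, 0, -1, -1, 0, 0]
/-- `α₂ = H2 - E3 - E4`. -/
def al2 : Pic := ![0, 1, 0, 0, -1, -1, 0, 0, 0, 0]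
/-- `α₃ = H1 - E7 - E8`. -/
def al3 : Pic := ![1, 0, 0, 0, 0, 0, 0, 0, -1, -1]
/-- `δ = 2H1 + 2H2 - E1 - ⋯ - E8`. -/
def dl : Pic := ![2, 2, -1, -1, -1, -1, -1, -1, -1, -1]
/-- `μ = H1 - H2`. -/
def mu : Pic := ![1, -1, 0, 0, 0, 0, 0, 0, 0, 0]

/-- Automorphisms of the lattice `Pic`, realized as invertible integer `10 × 10`
matrices (acting on coordinate vectors by matrix-vector multiplication). -/
abbrev PicAut : Type := (Matrix (Fin 10) (Fin 10) ℤ)ˣ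

/-- Build an automorphism of `Pic` out of an involutive matrix. -/
def mkAut (M : Matrix (Fin 10) (Fin 10) ℤ) (h : M * M = 1) : PicAut := ⟨M, M, h, h⟩

/-- `w₀`, the reflection `C ↦ C + (C•α₀)α₀`. -/
def w0 : PicAut := mkAut (reflMat al0) (by decide)
/-- `w₁`, the reflection `C ↦ C + (C•α₁)α₁`. -/
def w1 : PicAut := mkAut (reflMat al1) (by decide)
/-- `w₂`, the reflection `C ↦ C + (C•α₂)α₂`. -/
def w2 : PicAut := mkAut (reflMat al2) (by decide)
/-- `w₃`, the reflection `C ↦ C + (C•α₃)α₃`. -/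
def w3 : PicAut := mkAut (reflMat al3) (by decide)
/-- `σ₁`: the basis permutation `E1↔E7, E2↔E8, E3↔E5, E4↔E6` (fixing `H1`, `H2`)
composed with the reflection `w_μ` in `μ = H1 - H2`. -/
def sg1 : PicAut := mkAut (permMat ![0, 1, 8, 9, 6, 7, 4, 5, 2, 3] * reflMat mu) (by decide)
/-- `σ₂`: the basis permutation `E1↔E3, E2↔E4` (fixing the other basis vectors). -/
def sg2 : PicAut := mkAut (permMat ![0, 1, 4, 5, 2, 3, 6, 7, 8, 9]) (by decide)
/-- `σ₃`: the basis permutation `E5↔E7, E6↔E8` (fixing the other basis vectors). -/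
def sg3 : PicAut := mkAut (permMat ![0, 1, 2, 3, 4, 5, 8, 9, 6, 7]) (by decide)

/-- The action of an automorphism on `Pic`. -/
def act (g : PicAut) (v : Pic) : Pic := g.val.mulVec v

instance : MulAction PicAut Pic where
  smul := act
  one_smul v := by
    show act 1 v = v
    simp [act]
  mul_smul g h v := by
    show act (g * h) v = act g (act h v)
    simp [act, Matrix.mulVec_mulVec]

lemma smul_eq_act (g : PicAut) (v : Pic) : g • v = act g v := rfl

/-- The fully extended affine Weyl group `Ŵ` of type `A₃⁽¹⁾`, i.e. the subgroup
of automorphisms of `Pic` generated by `w₀, w₁, w₂, w₃, σ₁, σ₂`. -/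
def Wh : Subgroup PicAut := Subgroup.closure {w0, w1, w2, w3, sg1, sg2}

/-- `g = s₂s₁s₃s₀s₂` where `s₀ = w₀, s₁ = w₂, s₂ = w₃, s₃ = σ₃`. -/
def ge : PicAut := w3 * w2 * sg3 * w0 * w3

lemma act_mul (g h : PicAut) (v : Pic) : act (g * h) v = act g (act h v) :=
  mul_smul g h v

lemma act_add (g : PicAut) (u v : Pic) : act g (u + v) = act g u + act g v :=
  Matrix.mulVec_add _ _ _

lemma act_neg (g : PicAut) (v : Pic) : act g (-v) = -act g v :=
  Matrix.mulVec_neg _ _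

lemma act_sub (g : PicAut) (u v : Pic) : act g (u - v) = act g u - act g v :=
  Matrix.mulVec_sub _ _ _

lemma dl_eq_sum : dl = al0 + al1 + al2 + al3 := by decide

lemma act_w0 : act w0 al0 = -al0 ∧ act w0 al1 = al1 + al0 ∧
    act w0 al2 = al2 ∧ act w0 al3 = al3 + al0 := by decide

lemma act_w2 : act w2 al0 = al0 ∧ act w2 al1 = al1 + al2 ∧
    act w2 al2 = -al2 ∧ act w2 al3 = al3 + al2 := by decide

lemma act_w3 : act w3 al0 = al0 + al3 ∧ act w3 al1 = al1 ∧
    act w3 al2 = al2 + al3 ∧ act w3 al3 = -al3 := by decide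

lemma act_sg3 : act sg3 al0 = al0 ∧ act sg3 al1 = al3 ∧
    act sg3 al2 = al2 ∧ act sg3 al3 = al1 := by decide

/-- `g` maps `α₀ ↦ δ - α₀`, `α₁ ↦ δ - α₁`, `α₂ ↦ δ - α₂`, `α₃ ↦ -α₃ - δ`;
in particular `g(α₁ - α₃) = 2δ - (α₁ - α₃)`, i.e. `g` sends the short simple root
`b₃ = (α₁-α₃)/2` of the `B₃⁽¹⁾` system to `δ - b₃`. -/
theorem stmt10 :
    act ge al0 = dl - al0 ∧ act ge al1 = dl - al1 ∧
    act ge al2 = dl - al2 ∧ act ge al3 = -al3 - dl ∧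
    act ge (al1 - al3) = 2 • dl - (al1 - al3) := by
  refine ⟨?_, ?_, ?_, ?_, ?_⟩ <;>
    simp only [ge, act_mul, act_add, act_neg, act_sub, act_w0, act_w2, act_w3, act_sg3,
      dl_eq_sum] <;>
    abel
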